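/- For every integer w ≥ 2 and every Sylow 2-subgroup D̃ of the double cover Ã_{2w} of the alternating group, the central element z lies in the commutator subgroup of D̃; equivalently, every group homomorphism from D̃ to the multiplicative group ℂˣ sends z to 1 (there are no linear spin characters of D̃). -/

import Mathlib

/-- Relations defining the double cover `S̃ₙ` of the symmetric group:
generators are `none = z` and `some i = tᵢ` for `i : Fin (n-1)`, with relations
`z² = 1`, `tᵢ² = z`, `(tᵢ tᵢ₊₁)³ = z` and `(tᵢ tⱼ)² = z` for `|i - j| ≥ 2`. -/
def spinRels (n : ℕ) : Set (FreeGroup (Option (Fin (n - 1)))) :=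
  {r | r = FreeGroup.of (none : Option (Fin (n - 1))) ^ 2}
  ∪ {r | ∃ i : Fin (n - 1), r = FreeGroup.of (some i) ^ 2 * (FreeGroup.of none)⁻¹}
  ∪ {r | ∃ i j : Fin (n - 1), (j : ℕ) = (i : ℕ) + 1 ∧
      r = (FreeGroup.of (some i) * FreeGroup.of (some j)) ^ 3 * (FreeGroup.of none)⁻¹}
  ∪ {r | ∃ i j : Fin (n - 1), ((i : ℕ) + 2 ≤ (j : ℕ) ∨ (j : ℕ) + 2 ≤ (i : ℕ)) ∧
      r = (FreeGroup.of (some i) * FreeGroup.of (some j)) ^ 2 * (FreeGroup.of none)⁻¹}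

/-- The double cover `S̃ₙ` of the symmetric group, as a presented group. -/
abbrev SpinSym (n : ℕ) : Type := PresentedGroup (spinRels n)

/-- The central element `z` of `S̃ₙ`. -/
def spinZ (n : ℕ) : SpinSym n := PresentedGroup.of none

/-- The generator `tᵢ` of `S̃ₙ`. -/
def spinT (n : ℕ) (i : Fin (n - 1)) : SpinSym n := PresentedGroup.of (some i)

/-- The `i`-th point of `Fin n`, for `i : Fin (n-1)`. -/
def finL {n : ℕ} (i : Fin (n - 1)) : Fin n := ⟨(i : ℕ), by have := i.2; omega⟩

/-- The `(i+1)`-st point of `Fin n`, for `i : Fin (n-1)`. -/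
def finR {n : ℕ} (i : Fin (n - 1)) : Fin n := ⟨(i : ℕ) + 1, by have := i.2; omega⟩

/-- `π : S̃ₙ → Sₙ` is the canonical projection iff `π z = 1` and `π tᵢ` is the
transposition of the `i`-th and `(i+1)`-st points. -/
def IsSpinProj (n : ℕ) (π : SpinSym n →* Equiv.Perm (Fin n)) : Prop :=
  π (spinZ n) = 1 ∧ ∀ i : Fin (n - 1), π (spinT n i) = Equiv.swap (finL i) (finR i)

/-- The double cover `Ãₙ = π⁻¹(Aₙ)` of the alternating group, as a subgroup of `S̃ₙ`. -/
def SpinAlt (n : ℕ) (π : SpinSym n →* Equiv.Perm (Fin n)) : Subgroup (SpinSym n) :=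
  (alternatingGroup (Fin n)).comap π

/-- The central element `z`, as an element of `Ãₙ`. -/
def spinZA (n : ℕ) (π : SpinSym n →* Equiv.Perm (Fin n)) (hπ : IsSpinProj n π) :
    ↥(SpinAlt n π) :=
  ⟨spinZ n, Subgroup.mem_comap.mpr (by rw [hπ.1]; exact Subgroup.one_mem _)⟩

section CoxeterTypeA

variable {Q : Type*} [Group Q]

/-- The product `s (k + 1 - d) * ⋯ * s k` of the last `d` generators up to index `k`. -/
def descendingCosetRep (s : ℕ → Q) (k : ℕ) : ℕ → Q
  | 0 => 1
  | d + 1 => s (k - d) * descendingCosetRep s k d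

variable {s : ℕ → Q} {m k : ℕ}

theorem mul_descendingCosetRep_of_add_lt (hk : k < m)
    (comm : ∀ i j, i + 2 ≤ j → j < m → s i * s j = s j * s i) {i d : ℕ} (h : i + d < k) :
    s i * descendingCosetRep s k d = descendingCosetRep s k d * s i := by
  induction d with
  | zero => simp [descendingCosetRep]
  | succ d ih =>
    rw [descendingCosetRep, ← mul_assoc, comm i (k - d) (by omega) (by omega), mul_assoc,
      ih (by omega), mul_assoc]

theorem mul_descendingCosetRep_of_lt_add (hk : k < m)
    (braid : ∀ i, i + 1 < m → s i * s (i + 1) * s i = s (i + 1) * s i * s (i + 1))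
    (comm : ∀ i j, i + 2 ≤ j → j < m → s i * s j = s j * s i) {i d : ℕ} (hi : i ≤ k)
    (hd : d ≤ k + 1) (h : k + 1 < i + d) :
    s i * descendingCosetRep s k d = descendingCosetRep s k d * s (i - 1) := by
  induction d with
  | zero => omega
  | succ d ih =>
    rcases Nat.lt_or_ge (k + 1) (i + d) with h' | h'
    · rw [descendingCosetRep, ← mul_assoc, ← comm (k - d) i (by omega) (by omega), mul_assoc,
        ih (by omega) h', mul_assoc]
    · obtain ⟨j, rfl⟩ : ∃ j, i = j + 1 := ⟨i - 1, by omega⟩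
      obtain ⟨e, rfl⟩ : ∃ e, d = e + 1 := ⟨d - 1, by omega⟩
      have h1 : k - (e + 1) = j := by omega
      have h2 : k - e = j + 1 := by omega
      have h3 := mul_descendingCosetRep_of_add_lt hk comm (i := j) (d := e) (by omega)
      simp only [descendingCosetRep, h1, h2, Nat.add_sub_cancel]
      rw [mul_assoc, mul_assoc, ← h3, ← mul_assoc, ← mul_assoc, ← braid j (by omega)]
      simp only [mul_assoc]

/-- Elements satisfying the type `A` Coxeter relations generate a finite subgroup. -/
theorem finite_closure_image_Iio_of_braid
    (sq : ∀ i < m, s i * s i = 1)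
    (braid : ∀ i, i + 1 < m → s i * s (i + 1) * s i = s (i + 1) * s i * s (i + 1))
    (comm : ∀ i j, i + 2 ≤ j → j < m → s i * s j = s j * s i) (hk : k ≤ m) :
    (Subgroup.closure (s '' Set.Iio k) : Set Q).Finite := by
  induction k with
  | zero => simp
  | succ k ih =>
    set H := Subgroup.closure (s '' Set.Iio k)
    have mem : ∀ i < k, s i ∈ H := fun i hi => Subgroup.subset_closure ⟨i, hi, rfl⟩
    have step : ∀ i ≤ k, ∀ d ≤ k + 1, ∃ d' ≤ k + 1, ∃ h ∈ H,
        s i * descendingCosetRep s k d = descendingCosetRep s k d' * h := by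
      intro i hi d hd
      rcases lt_trichotomy (i + d) k with h | h | h
      · exact ⟨d, hd, s i, mem i (by omega), mul_descendingCosetRep_of_add_lt hk comm h⟩
      · refine ⟨d + 1, by omega, 1, one_mem _, ?_⟩
        rw [descendingCosetRep, mul_one, show k - d = i by omega]
      · rcases (Nat.succ_le_of_lt h).eq_or_lt with h | h
        · obtain ⟨e, rfl⟩ : ∃ e, d = e + 1 := ⟨d - 1, by omega⟩
          refine ⟨e, by omega, 1, one_mem _, ?_⟩
          rw [descendingCosetRep, show k - e = i by omega, ← mul_assoc, sq i (by omega), one_mul,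
            mul_one]
        · exact ⟨d, hd, s (i - 1), mem _ (by omega),
            mul_descendingCosetRep_of_lt_add hk braid comm hi hd h⟩
    refine (((Set.finite_Iic (k + 1)).image2 (fun d h => descendingCosetRep s k d * h)
      (ih (by omega)))).subset ?_
    have mul_mem : ∀ i ≤ k, ∀ y ∈ Set.image2 (fun d h => descendingCosetRep s k d * h)
        (Set.Iic (k + 1)) (H : Set Q), s i * y ∈
          Set.image2 (fun d h => descendingCosetRep s k d * h) (Set.Iic (k + 1)) (H : Set Q) := by
      rintro i hi _ ⟨d, hd, h, hh, rfl⟩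
      obtain ⟨d', hd', h', hh', e⟩ := step i hi d hd
      exact ⟨d', hd', h' * h, H.mul_mem hh' hh, by simp only [← mul_assoc, e]⟩
    intro x hx
    induction hx using Subgroup.closure_induction_left with
    | one => exact ⟨0, Nat.zero_le _, 1, H.one_mem, by simp [descendingCosetRep]⟩
    | mul_left x hx y _ ihy =>
      obtain ⟨i, hi, rfl⟩ := hx
      exact mul_mem i (Nat.le_of_lt_succ hi) y ihy
    | inv_mul_cancel x hx y _ ihy =>
      obtain ⟨i, hi, rfl⟩ := hx
      have hi' : i < k + 1 := hi
      rw [inv_eq_of_mul_eq_one_right (sq i (by omega))]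
      exact mul_mem i (by omega) y ihy

end CoxeterTypeA

section SpinRelations

variable {n : ℕ}

theorem spinZ_sq (n : ℕ) : spinZ n ^ 2 = 1 :=
  PresentedGroup.one_of_mem (rels := spinRels n) (Or.inl (Or.inl (Or.inl rfl)))

theorem spinT_sq (i : Fin (n - 1)) : spinT n i ^ 2 = spinZ n :=
  mul_inv_eq_one.mp <| PresentedGroup.one_of_mem (rels := spinRels n)
    (Or.inl (Or.inl (Or.inr ⟨i, rfl⟩)))

theorem spinT_mul_spinT_succ_pow_three (i j : Fin (n - 1)) (h : (j : ℕ) = i + 1) :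
    (spinT n i * spinT n j) ^ 3 = spinZ n :=
  mul_inv_eq_one.mp <| PresentedGroup.one_of_mem (rels := spinRels n)
    (Or.inl (Or.inr ⟨i, j, h, rfl⟩))

theorem spinT_mul_spinT_sq (i j : Fin (n - 1)) (h : (i : ℕ) + 2 ≤ j ∨ (j : ℕ) + 2 ≤ i) :
    (spinT n i * spinT n j) ^ 2 = spinZ n :=
  mul_inv_eq_one.mp <| PresentedGroup.one_of_mem (rels := spinRels n) (Or.inr ⟨i, j, h, rfl⟩)

theorem commute_spinZ (x : SpinSym n) : Commute (spinZ n) x := by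
  have hx : x ∈ Subgroup.closure (Set.range (PresentedGroup.of (rels := spinRels n))) := by
    rw [PresentedGroup.closure_range_of]
    trivial
  induction hx using Subgroup.closure_induction with
  | mem x hx =>
    obtain ⟨_ | i, rfl⟩ := hx
    · exact Commute.refl _
    · change Commute (spinZ n) (spinT n i)
      rw [← spinT_sq i]
      exact Commute.pow_self _ _
  | one => exact Commute.one_right _
  | mul x y _ _ hx hy => exact hx.mul_right hy
  | inv x _ hx => exact hx.inv_right

/-- The double cover of the symmetric group is finite. -/
instance finite_spinSym (n : ℕ) : Finite (SpinSym n) := by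
  let Z := Subgroup.zpowers (spinZ n)
  have : Z.Normal := by
    refine ⟨?_⟩
    rintro _ ⟨k, rfl⟩ x
    refine ⟨k, ?_⟩
    simp only [← ((commute_spinZ x).zpow_left k).eq, mul_inv_cancel_right]
  have : Finite Z := by
    refine Nat.finite_of_card_ne_zero ?_
    rw [Nat.card_zpowers]
    exact (isOfFinOrder_iff_pow_eq_one.mpr ⟨2, by norm_num, spinZ_sq n⟩).orderOf_pos.ne'
  let q := QuotientGroup.mk' Z
  have hz : q (spinZ n) = 1 := (QuotientGroup.eq_one_iff _).mpr (Subgroup.mem_zpowers _)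
  let s : ℕ → SpinSym n ⧸ Z := fun i => if h : i < n - 1 then q (spinT n ⟨i, h⟩) else 1
  have hs : ∀ i (h : i < n - 1), s i = q (spinT n ⟨i, h⟩) := fun i h => dif_pos h
  have sq : ∀ i < n - 1, s i * s i = 1 := by
    intro i h
    rw [hs i h, ← map_mul, ← pow_two, spinT_sq, hz]
  have inv : ∀ i < n - 1, (s i)⁻¹ = s i := fun i h => inv_eq_of_mul_eq_one_right (sq i h)
  have braid : ∀ i, i + 1 < n - 1 → s i * s (i + 1) * s i = s (i + 1) * s i * s (i + 1) := by
    intro i h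
    have e : (s i * s (i + 1)) ^ 3 = 1 := by
      rw [hs i (by omega), hs (i + 1) h, ← map_mul, ← map_pow,
        spinT_mul_spinT_succ_pow_three _ _ rfl, hz]
    have e' : (s i * s (i + 1) * s i) * (s (i + 1) * s i * s (i + 1)) = 1 := by
      rw [← e]; simp only [pow_succ, pow_zero, one_mul, mul_assoc]
    rw [eq_inv_of_mul_eq_one_left e']
    simp only [mul_inv_rev, inv i (by omega), inv (i + 1) h, mul_assoc]
  have comm : ∀ i j, i + 2 ≤ j → j < n - 1 → s i * s j = s j * s i := by
    intro i j h hj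
    have e : (s i * s j) ^ 2 = 1 := by
      rw [hs i (by omega), hs j hj, ← map_mul, ← map_pow, spinT_mul_spinT_sq _ _ (Or.inl h), hz]
    rw [pow_two] at e
    rw [eq_inv_of_mul_eq_one_left e, mul_inv_rev, inv i (by omega), inv j hj]
  have fin := finite_closure_image_Iio_of_braid sq braid comm le_rfl
  have top : Subgroup.closure (s '' Set.Iio (n - 1)) = ⊤ := by
    rw [eq_top_iff, ← Subgroup.map_top_of_surjective q (QuotientGroup.mk'_surjective Z),
      ← PresentedGroup.closure_range_of, MonoidHom.map_closure, Subgroup.closure_le]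
    rintro _ ⟨_, ⟨_ | i, rfl⟩, rfl⟩
    · exact (show q (spinZ n) ∈ _ from hz ▸ one_mem _)
    · exact Subgroup.subset_closure ⟨i, i.2, hs i i.2⟩
  rw [top, Subgroup.coe_top, Set.finite_univ_iff] at fin
  exact Finite.of_subgroup_quotient Z

end SpinRelations

section Quaternion

variable {G : Type*} [Group G]

/-- If `a` and `b` have order dividing 4 and `b` inverts `a`, the subgroup they generate is a
2-group. -/
theorem isPGroup_two_zpowers_sup_zpowers {a b : G} (ha : a ^ 4 = 1) (hb : b ^ 4 = 1)
    (hab : b * a * b⁻¹ = a⁻¹) : IsPGroup 2 ↥(Subgroup.zpowers b ⊔ Subgroup.zpowers a) := by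
  have key : ∀ g : G, g ^ 4 = 1 → IsPGroup 2 (Subgroup.zpowers g) := by
    rintro g hg ⟨_, k, rfl⟩
    refine ⟨2, Subtype.ext ?_⟩
    change (g ^ k) ^ (2 ^ 2) = 1
    rw [← zpow_natCast, zpow_comm, zpow_natCast]
    norm_num [hg]
  refine (key b hb).to_sup_of_normal_right' (key a ha) ?_
  rw [Subgroup.zpowers_le, Subgroup.mem_normalizer_iff_map_conj_eq, MonoidHom.map_zpowers]
  simp [MulAut.conj_apply, hab]

/-- In a finite group, a central element that is the commutator of two elements generating a
quaternion group lies in the commutator subgroup of every Sylow 2-subgroup. -/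
theorem mem_commutator_sylow_two_of_inverts [Finite G] {a b z : G} (hz : z ∈ Subgroup.center G)
    (hz2 : z ^ 2 = 1) (ha : a ^ 2 = z) (hb : b ^ 2 = z) (hab : b * a * b⁻¹ = a⁻¹)
    (D : Sylow 2 G) : z ∈ ⁅(D : Subgroup G), (D : Subgroup G)⁆ := by
  have ha4 : a ^ 4 = 1 := by rw [← hz2, ← ha, ← pow_mul]
  have hb4 : b ^ 4 = 1 := by rw [← hz2, ← hb, ← pow_mul]
  obtain ⟨S, hS⟩ := (isPGroup_two_zpowers_sup_zpowers ha4 hb4 hab).exists_le_sylow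
  have haS : a ∈ (S : Subgroup G) :=
    hS (Subgroup.mem_sup_right (Subgroup.mem_zpowers a))
  have hbS : b ∈ (S : Subgroup G) :=
    hS (Subgroup.mem_sup_left (Subgroup.mem_zpowers b))
  have hzS : z ∈ ⁅(S : Subgroup G), (S : Subgroup G)⁆ := by
    have h := Subgroup.commutator_mem_commutator hbS haS
    rwa [commutatorElement_def, hab, ← pow_two, inv_pow, ha,
      inv_eq_of_mul_eq_one_right (by rw [← pow_two, hz2])] at h
  obtain ⟨g, rfl⟩ := MulAction.exists_smul_eq G S D
  have h := Subgroup.mem_map_of_mem (MulAut.conj g).toMonoidHom hzS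
  rw [Subgroup.map_commutator] at h
  have hg : (MulAut.conj g).toMonoidHom z = z := by
    simp [Subgroup.mem_center_iff.mp hz g]
  rw [hg] at h
  exact h

/-- A homomorphism to a commutative group kills elements of the commutator of a subgroup. -/
theorem map_eq_one_of_mem_commutator {A : Type*} [CommGroup A] {H : Subgroup G} (f : H →* A) {z : G}
    (hz : z ∈ ⁅H, H⁆) (h : z ∈ H) : f ⟨z, h⟩ = 1 := by
  rw [← Subgroup.map_subtype_commutator] at hz
  obtain ⟨x, hx, rfl⟩ := hz
  exact Abelianization.commutator_subset_ker f hx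

/-- Two elements satisfying the spin version of the braid relation satisfy the braid relation. -/
theorem braid_of_mul_pow_three {g h z : G} (hz2 : z ^ 2 = 1) (hg : g ^ 2 = z) (hh : h ^ 2 = z)
    (hgh : (g * h) ^ 3 = z) : g * h * g = h * g * h := by
  have e : g * h * g * (h * g * h) = z := by
    rw [← hgh]
    simp only [pow_succ, pow_zero, one_mul, mul_assoc]
  have e' : h * g * h * (h * g * h) = z := by
    calc h * g * h * (h * g * h) = h * (g * h ^ 2 * g) * h := by simp only [pow_two, mul_assoc]
      _ = h * (g ^ 2 * g ^ 2) * h := by rw [hh, ← hg]; simp only [pow_two, mul_assoc]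
      _ = z := by rw [hg, ← pow_two, hz2, mul_one, ← pow_two, hh]
  exact mul_right_cancel (e.trans e'.symm)

/-- The spin relations between three consecutive generators give a quaternion group. -/
theorem conj_eq_inv_of_spin_relations {x y w z : G} (hz2 : z ^ 2 = 1) (hx : x ^ 2 = z)
    (hy : y ^ 2 = z) (hw : w ^ 2 = z) (hxy : (x * y) ^ 3 = z) (hyw : (y * w) ^ 3 = z)
    (hxw : (x * w) ^ 2 = z) :
    (y * (x * w) * y⁻¹) * (x * w) * (y * (x * w) * y⁻¹)⁻¹ = (x * w)⁻¹ := by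
  have comm : ∀ g : G, g ^ 2 = z → Commute z g := fun g hg => hg ▸ Commute.pow_self g 2
  have zz : z * z = 1 := by rw [← pow_two, hz2]
  have inv : ∀ g : G, g ^ 2 = z → g⁻¹ = z * g := fun g hg => by
    rw [inv_eq_iff_mul_eq_one, (comm g hg).eq, ← mul_assoc, ← pow_two, hg, zz]
  have bxy := braid_of_mul_pow_three hz2 hx hy hxy
  have byw := braid_of_mul_pow_three hz2 hy hw hyw
  have cx := comm x hx
  have cy := comm y hy
  have cw := comm w hw
  have hwx : w * x = z * (x * w) := by
    have e : x * w * (w * x) = 1 := by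
      rw [mul_assoc, ← mul_assoc w, ← pow_two w, hw, cx.eq, ← mul_assoc, ← pow_two, hx, zz]
    rw [← inv _ hxw, eq_inv_of_mul_eq_one_right e]
  have hprod : (x * w) * (y * (x * w) * y⁻¹) = (w * y) * (x * w) * (w * y)⁻¹ := by
    calc (x * w) * (y * (x * w) * y⁻¹) = z * (x * w) * (y * x * w * y) := by
          rw [inv y hy, ← mul_assoc _ z y, ← (cy.mul_right (cx.mul_right cw)).eq,
            (cx.mul_right cw).eq]
          simp only [mul_assoc]
      _ = w * (x * y * x) * w * y := by rw [← hwx]; simp only [mul_assoc]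
      _ = w * y * x * (y * w * y) := by rw [bxy]; simp only [mul_assoc]
      _ = w * y * (x * w) * (y * w) := by rw [byw]; simp only [mul_assoc]
      _ = (w * y) * (x * w) * (w * y)⁻¹ := by
          rw [mul_inv_rev, inv y hy, inv w hw, cy.eq, mul_assoc y z, ← mul_assoc z z, zz, one_mul]
  have hsq : ((x * w) * (y * (x * w) * y⁻¹)) ^ 2 = z := by
    rw [hprod, conj_pow, hxw, ← (cw.mul_right cy).eq, mul_inv_cancel_right]
  have hb : (y * (x * w) * y⁻¹) ^ 2 = z := by
    rw [conj_pow, hxw, ← cy.eq, mul_inv_cancel_right]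
  rw [pow_two] at hsq
  generalize y * (x * w) * y⁻¹ = b at *
  generalize x * w = a at *
  have e : b * a * b = a⁻¹ * z := by rw [← hsq]; simp only [mul_assoc, inv_mul_cancel_left]
  rw [inv b hb, (comm b hb).eq, ← mul_assoc, e, mul_assoc, zz, mul_one]

end Quaternion

/-- For `w ≥ 2` and `D̃` a Sylow 2-subgroup of `Ã₂ᵥᵥ`, the central element `z` lies in the
commutator subgroup of `D̃`; equivalently every homomorphism `D̃ →* ℂˣ` sends `z` to 1. -/
theorem spinZ_mem_commutator_sylow_spinAlt (w : ℕ) (hw : 2 ≤ w)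
    (π : SpinSym (2 * w) →* Equiv.Perm (Fin (2 * w))) (hπ : IsSpinProj (2 * w) π)
    (D : Sylow 2 ↥(SpinAlt (2 * w) π)) :
    spinZA (2 * w) π hπ ∈
      ⁅(D : Subgroup ↥(SpinAlt (2 * w) π)), (D : Subgroup ↥(SpinAlt (2 * w) π))⁆ ∧
    ∀ f : ↥(D : Subgroup ↥(SpinAlt (2 * w) π)) →* ℂˣ,
      ∀ h : spinZA (2 * w) π hπ ∈ (D : Subgroup ↥(SpinAlt (2 * w) π)),
        f ⟨spinZA (2 * w) π hπ, h⟩ = 1 := by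
  suffices hD : spinZA (2 * w) π hπ ∈
      ⁅(D : Subgroup ↥(SpinAlt (2 * w) π)), (D : Subgroup ↥(SpinAlt (2 * w) π))⁆ from
    ⟨hD, fun f h => map_eq_one_of_mem_commutator f hD h⟩
  let i₀ : Fin (2 * w - 1) := ⟨0, by omega⟩
  let i₁ : Fin (2 * w - 1) := ⟨1, by omega⟩
  let i₂ : Fin (2 * w - 1) := ⟨2, by omega⟩
  let x := spinT (2 * w) i₀
  let y := spinT (2 * w) i₁
  let u := spinT (2 * w) i₂
  have hxu : (x * u) ^ 2 = spinZ (2 * w) := spinT_mul_spinT_sq _ _ (Or.inl le_rfl)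
  have sign : ∀ i, Equiv.Perm.sign (π (spinT (2 * w) i)) = -1 := fun i => by
    rw [hπ.2 i, Equiv.Perm.sign_swap (by simp [finL, finR])]
  have ha : x * u ∈ SpinAlt (2 * w) π := by
    simp [SpinAlt, x, u, Equiv.Perm.mem_alternatingGroup, sign]
  have hb : y * (x * u) * y⁻¹ ∈ SpinAlt (2 * w) π := by
    simp [SpinAlt, x, u, y, Equiv.Perm.mem_alternatingGroup, sign]
  refine mem_commutator_sylow_two_of_inverts (a := ⟨x * u, ha⟩) (b := ⟨_, hb⟩) ?_ ?_ ?_ ?_ ?_ D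
  · exact Subgroup.mem_center_iff.mpr fun g => Subtype.ext (commute_spinZ g.1).eq.symm
  · exact Subtype.ext (spinZ_sq _)
  · exact Subtype.ext hxu
  · refine Subtype.ext ?_
    change (y * (x * u) * y⁻¹) ^ 2 = spinZ (2 * w)
    rw [conj_pow, hxu, ← (commute_spinZ y).eq, mul_inv_cancel_right]
  · exact Subtype.ext <| conj_eq_inv_of_spin_relations (spinZ_sq _) (spinT_sq i₀) (spinT_sq i₁)
      (spinT_sq i₂) (spinT_mul_spinT_succ_pow_three i₀ i₁ rfl)
      (spinT_mul_spinT_succ_pow_three i₁ i₂ rfl) hxu
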